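/- For every integer n ≥ 9, the full automorphism group of the graph Ψ_n = Cay(D_n, {τ_0, τ_1, τ_3}) is isomorphic to the dihedral group D_n of order 2n; that is, Ψ_n is a graphical regular representation of D_n. -/

import Mathlib

/-- The Cayley graph of a group on a (symmetric) connection set `S`:
distinct `g, h` are adjacent iff `g * h⁻¹ ∈ S`. -/
def cayley {G : Type*} [Group G] (S : Set G) : SimpleGraph G :=
  SimpleGraph.fromRel (fun x y => x * y⁻¹ ∈ S)

/-- In the dihedral group `D_n = ⟨ρ, τ⟩`, the element `τ_i = ρ^i * τ`. -/
def dihTau {n : ℕ} (i : ℕ) : DihedralGroup n :=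
  (DihedralGroup.r 1) ^ i * DihedralGroup.sr 0

/-- The graph `Ψ_n = Cay(D_n, {τ_0, τ_1, τ_3})`. -/
def psiGraph (n : ℕ) : SimpleGraph (DihedralGroup n) :=
  cayley ({dihTau 0, dihTau 1, dihTau 3} : Set (DihedralGroup n))

section SimpleGraph

variable {V : Type*} (G : SimpleGraph V)

/-- Two distinct vertices with a common neighbour. -/
def ShareNeighbor (u v : V) : Prop :=
  u ≠ v ∧ ∃ p, G.Adj u p ∧ G.Adj p v

/-- Two vertices sharing a neighbour, such that at least four vertices share a neighbour
with both of them. -/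
def Close (u v : V) : Prop :=
  ShareNeighbor G u v ∧
    ∃ s : Finset V, s.card = 4 ∧ ∀ w ∈ s, ShareNeighbor G u w ∧ ShareNeighbor G v w

/-- Some neighbour of `x` is close to `y`. -/
def HasCloseSibling (x y : V) : Prop :=
  ∃ z, G.Adj x z ∧ Close G y z

/-- Some neighbour of `x` other than `y` is two `Close`-steps away from `y`. -/
def HasTwoStepSibling (x y : V) : Prop :=
  ∃ z, G.Adj x z ∧ z ≠ y ∧ ∃ w, Close G y w ∧ Close G w z

variable {G}

theorem ShareNeighbor.symm {u v : V} (h : ShareNeighbor G u v) : ShareNeighbor G v u := by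
  obtain ⟨hne, p, h₁, h₂⟩ := h
  exact ⟨hne.symm, p, h₂.symm, h₁.symm⟩

theorem Close.symm {u v : V} (h : Close G u v) : Close G v u := by
  obtain ⟨huv, s, hs, hw⟩ := h
  exact ⟨huv.symm, s, hs, fun w h => (hw w h).symm⟩

theorem ShareNeighbor.map (f : G ≃g G) {u v : V} (h : ShareNeighbor G u v) :
    ShareNeighbor G (f u) (f v) := by
  obtain ⟨hne, p, h₁, h₂⟩ := h
  exact ⟨f.injective.ne hne, f p, f.map_adj_iff.2 h₁, f.map_adj_iff.2 h₂⟩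

theorem Close.map (f : G ≃g G) {u v : V} (h : Close G u v) : Close G (f u) (f v) := by
  obtain ⟨huv, s, hs, hw⟩ := h
  refine ⟨huv.map f, s.map f.toEquiv.toEmbedding, by rwa [Finset.card_map], fun w h => ?_⟩
  obtain ⟨w, hmem, rfl⟩ := Finset.mem_map.1 h
  exact ⟨(hw w hmem).1.map f, (hw w hmem).2.map f⟩

theorem HasCloseSibling.map (f : G ≃g G) {x y : V} (h : HasCloseSibling G x y) :
    HasCloseSibling G (f x) (f y) := by
  obtain ⟨z, hz, hyz⟩ := h
  exact ⟨f z, f.map_adj_iff.2 hz, hyz.map f⟩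

theorem HasTwoStepSibling.map (f : G ≃g G) {x y : V} (h : HasTwoStepSibling G x y) :
    HasTwoStepSibling G (f x) (f y) := by
  obtain ⟨z, hz, hne, w, hyw, hwz⟩ := h
  exact ⟨f z, f.map_adj_iff.2 hz, f.injective.ne hne, f w, hyw.map f, hwz.map f⟩

theorem hasCloseSibling_map_iff (f : G ≃g G) {x y : V} :
    HasCloseSibling G (f x) (f y) ↔ HasCloseSibling G x y :=
  ⟨fun h => by simpa using h.map f.symm, fun h => h.map f⟩

theorem hasTwoStepSibling_map_iff (f : G ≃g G) {x y : V} :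
    HasTwoStepSibling G (f x) (f y) ↔ HasTwoStepSibling G x y :=
  ⟨fun h => by simpa using h.map f.symm, fun h => h.map f⟩

end SimpleGraph

section Cayley

variable {G : Type*} [Group G]

/-- Right translation by `g⁻¹` is an automorphism of a Cayley graph. -/
def cayleyTranslation (S : Set G) : G →* (cayley S ≃g cayley S) where
  toFun g := ⟨Equiv.mulRight g⁻¹, by simp [cayley]⟩
  map_one' := by ext; simp
  map_mul' g h := by ext; simp [mul_assoc]

theorem cayleyTranslation_apply (S : Set G) (g x : G) :
    cayleyTranslation S g x = x * g⁻¹ := rfl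

/-- If all automorphisms of a Cayley graph commute with left multiplication, then the graph is a
graphical regular representation. -/
theorem nonempty_cayley_aut_mulEquiv (S : Set G)
    (h : ∀ (f : cayley S ≃g cayley S) (g x : G), f (g * x) = g * f x) :
    Nonempty ((cayley S ≃g cayley S) ≃* G) := by
  refine ⟨(MulEquiv.ofBijective (cayleyTranslation S) ⟨fun a b hab => ?_, fun f => ?_⟩).symm⟩
  · simpa [cayleyTranslation_apply] using DFunLike.congr_fun hab 1
  · refine ⟨(f 1)⁻¹, RelIso.ext fun x => ?_⟩
    rw [cayleyTranslation_apply, inv_inv, ← h f x 1, mul_one]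

end Cayley

section Psi

open DihedralGroup

variable {n : ℕ}

theorem dihTau_eq_sr (c : ℕ) : (dihTau c : DihedralGroup n) = sr (-(c : ℤ) : ℤ) := by
  simp [dihTau]

theorem psiGraph_adj (x y : DihedralGroup n) :
    (psiGraph n).Adj x y ↔
      ∃ c : ℤ, (c = 0 ∨ c = 1 ∨ c = 3) ∧ y = sr (-c : ℤ) * x := by
  have hinv (c : ℕ) : x * y⁻¹ = dihTau c ↔ y * x⁻¹ = dihTau c := by
    rw [← inv_inj, dihTau_eq_sr, inv_sr]
    simp
  have hne (c : ℤ) (h : y = sr (-c : ℤ) * x) : x ≠ y := by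
    rintro rfl
    exact absurd (right_eq_mul.1 h) (by rw [one_def]; simp [-r_zero])
  simp only [psiGraph, cayley, SimpleGraph.fromRel_adj, Set.mem_insert_iff,
    Set.mem_singleton_iff, hinv, or_self]
  simp only [dihTau_eq_sr, mul_inv_eq_iff_eq_mul]
  constructor
  · rintro ⟨-, h | h | h⟩
    exacts [⟨0, by simp, h⟩, ⟨1, by simp, h⟩, ⟨3, by simp, h⟩]
  · rintro ⟨c, hc, h⟩
    refine ⟨hne c h, ?_⟩
    rcases hc with rfl | rfl | rfl
    exacts [Or.inl h, Or.inr (Or.inl h), Or.inr (Or.inr h)]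

theorem r_intCast_mul_eq_iff (a b : ℤ) (u : DihedralGroup n) :
    r (a : ZMod n) * u = r (b : ZMod n) * u ↔ (n : ℤ) ∣ a - b := by
  rw [mul_left_inj, r.injEq, ← sub_eq_zero, ← Int.cast_sub, ZMod.intCast_zmod_eq_zero_iff_dvd]

theorem sr_mul_eq_r_mul_sr (a b : ℤ) (x : DihedralGroup n) :
    sr (-b : ℤ) * x = r (b - a : ℤ) * (sr (-a : ℤ) * x) := by
  rw [← mul_assoc, r_mul_sr]
  congr 2
  push_cast
  ring

theorem r_mul_r_mul (a b : ℤ) (x : DihedralGroup n) :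
    r (a : ZMod n) * (r (b : ZMod n) * x) = r (a + b : ℤ) * x := by
  rw [← mul_assoc, r_mul_r, Int.cast_add]

theorem eq_zero_of_dvd_of_lt (hn : 9 ≤ n) {k : ℤ} (hk : (n : ℤ) ∣ k) (h : |k| < 9) : k = 0 :=
  Int.eq_zero_of_abs_lt_dvd hk (by omega)

theorem shareNeighbor_psiGraph (hn : 9 ≤ n) (u v : DihedralGroup n) :
    ShareNeighbor (psiGraph n) u v ↔ ∃ d : ℤ, d ≠ 0 ∧ |d| ≤ 3 ∧ v = r (d : ZMod n) * u := by
  simp only [ShareNeighbor, psiGraph_adj]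
  constructor
  · rintro ⟨hne, -, ⟨a, ha, rfl⟩, b, hb, rfl⟩
    have h : sr (-b : ℤ) * (sr (-a : ℤ) * u) = r (b - a : ℤ) * u := by
      rw [← mul_assoc, sr_mul_sr]
      congr 2
      push_cast
      ring
    rw [h] at hne ⊢
    refine ⟨b - a, fun h0 => hne ?_, ?_, rfl⟩
    · rw [h0, Int.cast_zero, r_zero, one_mul]
    · rw [abs_le]; omega
  · rintro ⟨d, h0, hd, rfl⟩
    constructor
    · intro h
      have h' : r ((0 : ℤ) : ZMod n) * u = r (d : ZMod n) * u := by
        rwa [Int.cast_zero, r_zero, one_mul]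
      have := eq_zero_of_dvd_of_lt hn ((r_intCast_mul_eq_iff _ _ _).1 h') (by
        rw [abs_le] at hd; rw [abs_lt]; omega)
      omega
    · obtain ⟨a, b, ha, hb, hab⟩ : ∃ a b : ℤ, (a = 0 ∨ a = 1 ∨ a = 3) ∧
          (b = 0 ∨ b = 1 ∨ b = 3) ∧ d = b - a := by
        rw [abs_le] at hd
        obtain h | h | h | h | h | h :
          d = -3 ∨ d = -2 ∨ d = -1 ∨ d = 1 ∨ d = 2 ∨ d = 3 := by omega
        exacts [⟨3, 0, by omega⟩, ⟨3, 1, by omega⟩, ⟨1, 0, by omega⟩, ⟨0, 1, by omega⟩,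
          ⟨1, 3, by omega⟩, ⟨0, 3, by omega⟩]
      refine ⟨_, ⟨a, ha, rfl⟩, b, hb, ?_⟩
      rw [← mul_assoc, sr_mul_sr, hab]
      congr 2
      push_cast
      ring

theorem close_r_one_mul (hn : 9 ≤ n) (u : DihedralGroup n) :
    Close (psiGraph n) u (r (1 : ℤ) * u) := by
  classical
  refine ⟨(shareNeighbor_psiGraph hn _ _).2 ⟨1, by simp, by simp, rfl⟩,
    ({-2, -1, 2, 3} : Finset ℤ).image fun d : ℤ => r (d : ZMod n) * u, ?_, fun w hw => ?_⟩
  · rw [Finset.card_image_of_injOn]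
    · rfl
    · intro a ha b hb hab
      simp only [Finset.coe_insert, Finset.coe_singleton, Set.mem_insert_iff,
        Set.mem_singleton_iff] at ha hb
      have := eq_zero_of_dvd_of_lt hn ((r_intCast_mul_eq_iff _ _ _).1 hab) (by
        rw [abs_lt]; omega)
      omega
  · obtain ⟨d, hd, rfl⟩ := Finset.mem_image.1 hw
    simp only [Finset.mem_insert, Finset.mem_singleton] at hd
    refine ⟨(shareNeighbor_psiGraph hn _ _).2 ⟨d, by omega, by rw [abs_le]; omega, rfl⟩,
      (shareNeighbor_psiGraph hn _ _).2 ⟨d - 1, by omega, by rw [abs_le]; omega, ?_⟩⟩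
    rw [r_mul_r_mul, sub_add_cancel]

theorem not_close_r_mul (hn : 9 ≤ n) (u : DihedralGroup n) {e : ℤ} (he : e = 2 ∨ e = 3) :
    ¬ Close (psiGraph n) u (r (e : ZMod n) * u) := by
  classical
  rintro ⟨-, s, hs, hw⟩
  have key : ∃ t : Finset ℤ, t.card ≤ 3 ∧ ∀ d d' : ℤ, d ≠ 0 → d' ≠ 0 → |d| ≤ 3 → |d'| ≤ 3 →
      (n : ℤ) ∣ d - (d' + e) → d ∈ t := by
    rcases he with rfl | rfl
    · refine ⟨{-1, 1, 3}, by decide, fun d d' h h' hd hd' hdvd => ?_⟩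
      rw [abs_le] at hd hd'
      have := eq_zero_of_dvd_of_lt hn hdvd (by rw [abs_lt]; omega)
      simp only [Finset.mem_insert, Finset.mem_singleton]
      omega
    · refine ⟨{1, 2, -3}, by decide, fun d d' h h' hd hd' hdvd => ?_⟩
      rw [abs_le] at hd hd'
      simp only [Finset.mem_insert, Finset.mem_singleton]
      by_cases hlt : |d - (d' + 3)| < 9
      · have := eq_zero_of_dvd_of_lt hn hdvd hlt
        omega
      · rw [abs_lt] at hlt
        omega
  obtain ⟨t, ht, hmem⟩ := key
  have hsub : s ⊆ t.image fun d : ℤ => r (d : ZMod n) * u := by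
    intro w h
    obtain ⟨h₁, h₂⟩ := hw w h
    obtain ⟨d, h0, hd, rfl⟩ := (shareNeighbor_psiGraph hn _ _).1 h₁
    obtain ⟨d', h0', hd', h'⟩ := (shareNeighbor_psiGraph hn _ _).1 h₂
    rw [r_mul_r_mul, r_intCast_mul_eq_iff] at h'
    exact Finset.mem_image_of_mem _ (hmem d d' h0 h0' hd hd' h')
  have := (Finset.card_le_card hsub).trans Finset.card_image_le
  omega

theorem close_psiGraph (hn : 9 ≤ n) (u v : DihedralGroup n) :
    Close (psiGraph n) u v ↔ ∃ e : ℤ, (e = 1 ∨ e = -1) ∧ v = r (e : ZMod n) * u := by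
  have hback (e : ℤ) : u = r (-e : ℤ) * (r (e : ZMod n) * u) := by
    rw [r_mul_r_mul, neg_add_cancel, Int.cast_zero, r_zero, one_mul]
  constructor
  · intro h
    obtain ⟨e, h0, he, rfl⟩ := (shareNeighbor_psiGraph hn _ _).1 h.1
    refine ⟨e, ?_, rfl⟩
    by_contra hcon
    rw [abs_le] at he
    by_cases hpos : 0 < e
    · exact not_close_r_mul hn u (by omega) h
    · have h' := h.symm
      nth_rw 2 [hback e] at h'
      exact not_close_r_mul hn _ (by omega) h'
  · rintro ⟨e, rfl | rfl, rfl⟩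
    · exact close_r_one_mul hn u
    · have h := close_r_one_mul hn (r ((-1 : ℤ) : ZMod n) * u)
      rw [r_mul_r_mul, add_neg_cancel, Int.cast_zero, r_zero, one_mul] at h
      exact h.symm

theorem hasCloseSibling_psiGraph (hn : 9 ≤ n) (x : DihedralGroup n) {c : ℤ}
    (hc : c = 0 ∨ c = 1 ∨ c = 3) :
    HasCloseSibling (psiGraph n) x (sr (-c : ℤ) * x) ↔ c ≠ 3 := by
  simp only [HasCloseSibling, psiGraph_adj, close_psiGraph hn]
  constructor
  · rintro ⟨-, ⟨b, hb, rfl⟩, e, he, h⟩ rfl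
    rw [sr_mul_eq_r_mul_sr 3 b, r_intCast_mul_eq_iff] at h
    have := eq_zero_of_dvd_of_lt hn h (by rw [abs_lt]; omega)
    omega
  · intro h3
    exact ⟨_, ⟨1 - c, by omega, rfl⟩, 1 - c - c, by omega, sr_mul_eq_r_mul_sr c (1 - c) x⟩

theorem hasTwoStepSibling_psiGraph (hn : 9 ≤ n) (x : DihedralGroup n) {c : ℤ}
    (hc : c = 0 ∨ c = 1 ∨ c = 3) :
    HasTwoStepSibling (psiGraph n) x (sr (-c : ℤ) * x) ↔ c ≠ 0 := by
  simp only [HasTwoStepSibling, psiGraph_adj, close_psiGraph hn]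
  constructor
  · rintro ⟨-, ⟨b, hb, rfl⟩, hne, -, ⟨e, he, rfl⟩, e', he', h⟩ rfl
    rw [r_mul_r_mul, sr_mul_eq_r_mul_sr 0 b, r_intCast_mul_eq_iff] at h
    have := eq_zero_of_dvd_of_lt hn h (by rw [abs_lt]; omega)
    obtain rfl : b = 0 := by omega
    exact hne rfl
  · intro h0
    refine ⟨_, ⟨4 - c, by omega, rfl⟩, fun h => ?_, _, ⟨2 - c, by omega, rfl⟩,
      2 - c, by omega, ?_⟩
    · rw [mul_left_inj, sr.injEq, ← sub_eq_zero, ← Int.cast_sub,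
        ZMod.intCast_zmod_eq_zero_iff_dvd] at h
      have := eq_zero_of_dvd_of_lt hn h (by rw [abs_lt]; omega)
      omega
    · rw [r_mul_r_mul, sr_mul_eq_r_mul_sr c (4 - c)]
      congr 3
      ring

theorem psiGraph_aut_sr_mul (hn : 9 ≤ n) (f : psiGraph n ≃g psiGraph n) {c : ℤ}
    (hc : c = 0 ∨ c = 1 ∨ c = 3) (x : DihedralGroup n) :
    f (sr (-c : ℤ) * x) = sr (-c : ℤ) * f x := by
  obtain ⟨b, hb, h⟩ := (psiGraph_adj (f x) _).1
    (f.map_adj_iff.2 ((psiGraph_adj x _).2 ⟨c, hc, rfl⟩))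
  have h₁ := hasCloseSibling_map_iff f (x := x) (y := sr (-c : ℤ) * x)
  have h₂ := hasTwoStepSibling_map_iff f (x := x) (y := sr (-c : ℤ) * x)
  rw [h, hasCloseSibling_psiGraph hn _ hb, hasCloseSibling_psiGraph hn _ hc] at h₁
  rw [h, hasTwoStepSibling_psiGraph hn _ hb, hasTwoStepSibling_psiGraph hn _ hc] at h₂
  obtain rfl : b = c := by omega
  exact h

theorem psiGraph_aut_mul (hn : 9 ≤ n) (f : psiGraph n ≃g psiGraph n) (g x : DihedralGroup n) :
    f (g * x) = g * f x := by
  have h0 (x : DihedralGroup n) : f (sr 0 * x) = sr 0 * f x := by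
    simpa using psiGraph_aut_sr_mul hn f (c := 0) (by simp) x
  have h1 (x : DihedralGroup n) : f (r 1 * x) = r 1 * f x := by
    have hr : (r 1 : DihedralGroup n) = sr (-1 : ℤ) * sr 0 := by simp
    rw [hr, mul_assoc, psiGraph_aut_sr_mul hn f (by simp), h0, mul_assoc]
  have hpow (k : ℕ) (x : DihedralGroup n) : f (r 1 ^ k * x) = r 1 ^ k * f x := by
    induction k generalizing x with
    | zero => simp
    | succ k ih => rw [pow_succ, mul_assoc, ih, h1, mul_assoc]
  have : NeZero n := ⟨by omega⟩
  have hr (i : ZMod n) (x : DihedralGroup n) : f (r i * x) = r i * f x := by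
    simpa using hpow i.val x
  cases g with
  | r i => exact hr i x
  | sr i =>
    have hi : (sr i : DihedralGroup n) = sr 0 * r i := by simp
    rw [hi, mul_assoc, h0, hr, mul_assoc]

end Psi

/-- For `n ≥ 9`, the full automorphism group of `Ψ_n` is isomorphic to the dihedral
group `D_n` of order `2n`, i.e. `Ψ_n` is a graphical regular representation of `D_n`. -/
theorem psi_aut_eq_dihedral (n : ℕ) (hn : 9 ≤ n) :
    Nonempty ((psiGraph n ≃g psiGraph n) ≃* DihedralGroup n) :=
  nonempty_cayley_aut_mulEquiv _ (psiGraph_aut_mul hn)
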